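/- Let a < b be real numbers and let k be a nonnegative integer. Then there is a real polynomial p of degree k + 1 such that for every t ∈ (a,b), (1/π) p.v. ∫_a^b s^k √((b−s)(s−a)) / (t−s) ds = p(t). -/

import Mathlib

open MeasureTheory Real Filter Topology Metric Set
open scoped RealInnerProductSpace

noncomputable section

/-- Euclidean space ℝⁿ. -/
abbrev En (n : ℕ) := EuclideanSpace ℝ (Fin n)

/-- A convex body: compact, convex, with nonempty interior. -/
def IsConvexBody {n : ℕ} (K : Set (En n)) : Prop :=
  IsCompact K ∧ Convex ℝ K ∧ (interior K).Nonempty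

/-- `K` has C^∞ (infinitely smooth) boundary: near every boundary point, the boundary is the
zero set of a smooth local defining function with nonvanishing derivative. -/
def HasSmoothBoundary {n : ℕ} (K : Set (En n)) : Prop :=
  ∀ x ∈ frontier K, ∃ (U : Set (En n)) (f : En n → ℝ),
    IsOpen U ∧ x ∈ U ∧ ContDiffOn ℝ (⊤ : ℕ∞) f U ∧
    (∀ y ∈ U, fderiv ℝ f y ≠ 0) ∧ (U ∩ frontier K = {y ∈ U | f y = 0})

/-- The sectional volume function `A_K(ξ,t)`: the (n-1)-dimensional Hausdorff measure of the
section of `K` by the hyperplane `{x : x·ξ = t}`. -/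
def sectionVol {n : ℕ} (K : Set (En n)) (ξ : En n) (t : ℝ) : ℝ :=
  (μH[(n : ℝ) - 1] (K ∩ {x : En n | ⟪x, ξ⟫ = t})).toReal

/-- The support function `h_K⁺(ξ) = max_{x ∈ K} x·ξ`. -/
def suppP {n : ℕ} (K : Set (En n)) (ξ : En n) : ℝ :=
  sSup ((fun x => ⟪x, ξ⟫) '' K)

/-- `h_K⁻(ξ) = min_{x ∈ K} x·ξ`. -/
def suppM {n : ℕ} (K : Set (En n)) (ξ : En n) : ℝ :=
  sInf ((fun x => ⟪x, ξ⟫) '' K)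

/-- The open interval `I_ξ = (h_K⁻(ξ), h_K⁺(ξ))`. -/
def Iseg {n : ℕ} (K : Set (En n)) (ξ : En n) : Set ℝ :=
  Set.Ioo (suppM K ξ) (suppP K ξ)

/-- `HilbertAt f t L` : the Hilbert transform `(1/π) p.v. ∫ f(s)/(t-s) ds` of `f` at `t`
exists (as a principal value) and equals `L`. -/
def HilbertAt (f : ℝ → ℝ) (t L : ℝ) : Prop :=
  Tendsto (fun ε : ℝ => (1 / π) * ∫ s in {s : ℝ | ε ≤ |t - s|}, f s / (t - s))
    (𝓝[>] (0 : ℝ)) (𝓝 L)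

/-- An ellipsoid: the image of the closed unit ball under an invertible affine map. -/
def IsEllipsoid {n : ℕ} (K : Set (En n)) : Prop :=
  ∃ T : En n ≃ᵃ[ℝ] En n, K = T '' (Metric.closedBall (0 : En n) 1)

theorem setIntegral_indicator_truncated {a b t ε : ℝ} (hε : 0 < ε) (hat : ε < t - a)
    (htb : ε < b - t) {f : ℝ → ℝ} (hf : Continuous f) :
    ∫ s in {s : ℝ | ε ≤ |t - s|}, (Set.Icc a b).indicator f s / (t - s) =
      (∫ s in a..(t - ε), f s / (t - s)) + ∫ s in (t + ε)..b, f s / (t - s) := by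
  have hind : (fun s => (Set.Icc a b).indicator f s / (t - s)) =
      (Set.Icc a b).indicator (fun s => f s / (t - s)) := by
    ext s
    by_cases hs : s ∈ Set.Icc a b <;> simp [hs]
  have hset : {s : ℝ | ε ≤ |t - s|} ∩ Set.Icc a b = Set.Icc a (t - ε) ∪ Set.Icc (t + ε) b := by
    ext s
    simp only [mem_inter_iff, mem_ofPred_eq, mem_Icc, mem_union, le_abs]
    constructor
    · rintro ⟨h | h, h1, h2⟩
      · left; constructor <;> linarith
      · right; constructor <;> linarith
    · rintro (⟨h1, h2⟩ | ⟨h1, h2⟩)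
      · exact ⟨Or.inl (by linarith), by linarith, by linarith⟩
      · exact ⟨Or.inr (by linarith), by linarith, by linarith⟩
  have hc1 : ContinuousOn (fun s => f s / (t - s)) (Set.Icc a (t - ε)) :=
    hf.continuousOn.div (by fun_prop) fun s hs => by have := hs.2; exact ne_of_gt (by linarith)
  have hc2 : ContinuousOn (fun s => f s / (t - s)) (Set.Icc (t + ε) b) :=
    hf.continuousOn.div (by fun_prop) fun s hs => by have := hs.1; exact ne_of_lt (by linarith)
  rw [hind, setIntegral_indicator measurableSet_Icc, hset,
    setIntegral_union _ measurableSet_Icc hc1.integrableOn_Icc hc2.integrableOn_Icc,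
    integral_Icc_eq_integral_Ioc, integral_Icc_eq_integral_Ioc,
    intervalIntegral.integral_of_le (by linarith), intervalIntegral.integral_of_le (by linarith)]
  rw [Set.disjoint_left]
  intro s h1 h2
  have := h1.2
  have := h2.1
  linarith

theorem hilbertAt_indicator_iff {a b t L : ℝ} (ht : t ∈ Set.Ioo a b) {f : ℝ → ℝ}
    (hf : Continuous f) :
    HilbertAt ((Set.Icc a b).indicator f) t L ↔
      Tendsto (fun ε : ℝ => (1 / π) *
        ((∫ s in a..(t - ε), f s / (t - s)) + ∫ s in (t + ε)..b, f s / (t - s)))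
        (𝓝[>] (0 : ℝ)) (𝓝 L) := by
  refine tendsto_congr' ?_
  have h1 : ∀ᶠ ε in 𝓝[>] (0 : ℝ), ε < t - a :=
    nhdsWithin_le_nhds (eventually_lt_nhds (sub_pos.2 ht.1))
  have h2 : ∀ᶠ ε in 𝓝[>] (0 : ℝ), ε < b - t :=
    nhdsWithin_le_nhds (eventually_lt_nhds (sub_pos.2 ht.2))
  filter_upwards [self_mem_nhdsWithin, h1, h2] with ε hε h1 h2
  rw [setIntegral_indicator_truncated hε h1 h2 hf]

theorem HilbertAt.indicator_id_mul {a b t L : ℝ} (ht : t ∈ Set.Ioo a b) {f : ℝ → ℝ}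
    (hf : Continuous f) (h : HilbertAt ((Set.Icc a b).indicator f) t L) :
    HilbertAt ((Set.Icc a b).indicator (fun s => s * f s)) t
      (t * L - (1 / π) * ∫ s in a..b, f s) := by
  rw [hilbertAt_indicator_iff ht hf] at h
  rw [hilbertAt_indicator_iff ht (by fun_prop : Continuous fun s => s * f s)]
  have hint : ∀ x y, IntervalIntegrable f volume x y := fun x y => hf.intervalIntegrable x y
  have hlim : Tendsto (fun ε : ℝ => (∫ s in a..(t - ε), f s) + ∫ s in (t + ε)..b, f s)
      (𝓝[>] (0 : ℝ)) (𝓝 (∫ s in a..b, f s)) := by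
    have hc : Continuous fun ε : ℝ => (∫ s in a..(t - ε), f s) + ∫ s in (t + ε)..b, f s := by
      refine Continuous.add ?_ ?_
      · exact (intervalIntegral.continuous_primitive hint a).comp
          (by fun_prop : Continuous fun ε : ℝ => t - ε)
      · simp_rw [intervalIntegral.integral_symm b]
        exact ((intervalIntegral.continuous_primitive hint b).comp
          (by fun_prop : Continuous fun ε : ℝ => t + ε)).neg
    have := hc.tendsto 0
    simp only [sub_zero, add_zero] at this
    rw [intervalIntegral.integral_add_adjacent_intervals (hint _ _) (hint _ _)] at this
    exact this.mono_left nhdsWithin_le_nhds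
  refine ((h.const_mul t).sub (hlim.const_mul (1 / π))).congr' ?_
  have h1 : ∀ᶠ ε in 𝓝[>] (0 : ℝ), ε < t - a :=
    nhdsWithin_le_nhds (eventually_lt_nhds (sub_pos.2 ht.1))
  have h2 : ∀ᶠ ε in 𝓝[>] (0 : ℝ), ε < b - t :=
    nhdsWithin_le_nhds (eventually_lt_nhds (sub_pos.2 ht.2))
  filter_upwards [self_mem_nhdsWithin, h1, h2] with ε hε h1 h2
  have hε : 0 < ε := hε
  have key : ∀ x y, (∀ s ∈ Set.uIcc x y, t - s ≠ 0) →
      ∫ s in x..y, s * f s / (t - s) =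
        t * (∫ s in x..y, f s / (t - s)) - ∫ s in x..y, f s := by
    intro x y hxy
    have hi : IntervalIntegrable (fun s => f s / (t - s)) volume x y :=
      (hf.continuousOn.div (by fun_prop) hxy).intervalIntegrable
    rw [← intervalIntegral.integral_const_mul, ← intervalIntegral.integral_sub
      (hi.const_mul t) (hint x y)]
    refine intervalIntegral.integral_congr fun s hs => ?_
    have := hxy s hs
    field_simp
    ring
  rw [key a (t - ε), key (t + ε) b]
  · ring
  · intro s hs
    rw [uIcc_of_le (by linarith)] at hs
    have := hs.1
    exact ne_of_lt (by linarith)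
  · intro s hs
    rw [uIcc_of_le (by linarith)] at hs
    have := hs.2
    exact ne_of_gt (by linarith)

/-- The continuous part of a primitive of `√((b-s)(s-a)) / (t-s)`; the remaining part is
`-√((b-t)(t-a)) log |s-t|`. -/
def semicirclePrimitive (a b t s : ℝ) : ℝ :=
  √(b - t) * √(t - a) * (2 * log (√(b - t) * √(s - a) + √(t - a) * √(b - s)))
    - √(b - s) * √(s - a) + (t - (a + b) / 2) * arcsin ((2 * s - a - b) / (b - a))

theorem sqrt_mul_add_sqrt_mul_pos {a b t s : ℝ} (ht : t ∈ Set.Ioo a b) (hs : s ∈ Set.Icc a b) :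
    0 < √(b - t) * √(s - a) + √(t - a) * √(b - s) := by
  have hp : 0 < √(b - t) := sqrt_pos.2 (sub_pos.2 ht.2)
  have hq : 0 < √(t - a) := sqrt_pos.2 (sub_pos.2 ht.1)
  rcases hs.1.eq_or_lt with h | h
  · have : 0 < √(b - s) := sqrt_pos.2 (by linarith [ht.1, ht.2])
    positivity
  · have : 0 < √(s - a) := sqrt_pos.2 (by linarith)
    positivity

theorem continuousOn_semicirclePrimitive {a b t : ℝ} (ht : t ∈ Set.Ioo a b) :
    ContinuousOn (semicirclePrimitive a b t) (Set.Icc a b) := by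
  unfold semicirclePrimitive
  refine ((continuousOn_const.mul (continuousOn_const.mul (ContinuousOn.log (by fun_prop)
    fun s hs => (sqrt_mul_add_sqrt_mul_pos ht hs).ne'))).sub (by fun_prop)).add ?_
  exact continuousOn_const.mul (continuous_arcsin.comp (by fun_prop)).continuousOn

theorem hasDerivAt_semicirclePrimitive {a b t s : ℝ} (ht : t ∈ Set.Ioo a b)
    (hs : s ∈ Set.Ioo a b) (hst : s ≠ t) :
    HasDerivAt (fun x => semicirclePrimitive a b t x - √(b - t) * √(t - a) * log (x - t))
      (√((b - s) * (s - a)) / (t - s)) s := by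
  have hpos := sqrt_mul_add_sqrt_mul_pos ht ⟨hs.1.le, hs.2.le⟩
  have hp : 0 < b - t := sub_pos.2 ht.2
  have hq : 0 < t - a := sub_pos.2 ht.1
  have hy : 0 < b - s := sub_pos.2 hs.2
  have hx : 0 < s - a := sub_pos.2 hs.1
  have hr : 0 < b - a := by linarith
  have hX : HasDerivAt (fun x => √(x - a)) (1 / (2 * √(s - a))) s :=
    ((hasDerivAt_id s).sub_const a).sqrt hx.ne'
  have hY : HasDerivAt (fun x => √(b - x)) (-1 / (2 * √(b - s))) s :=
    ((hasDerivAt_id s).const_sub b).sqrt hy.ne'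
  have hsq : √(1 - ((2 * s - a - b) / (b - a)) ^ 2) = 2 * (√(b - s) * √(s - a)) / (b - a) := by
    rw [← sqrt_mul hy.le, sqrt_eq_iff_mul_self_eq_of_pos (by positivity), ← pow_two, div_pow,
      mul_pow, sq_sqrt (by positivity)]
    field_simp
    ring
  have hz1 : (2 * s - a - b) / (b - a) ≠ -1 := by
    rw [ne_eq, div_eq_iff hr.ne']; intro h; linarith
  have hz2 : (2 * s - a - b) / (b - a) ≠ 1 := by
    rw [ne_eq, div_eq_iff hr.ne']; intro h; linarith
  have hA : HasDerivAt (fun x => arcsin ((2 * x - a - b) / (b - a)))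
      (1 / (√(b - s) * √(s - a))) s := by
    have h := (hasDerivAt_arcsin hz1 hz2).comp s
      (((((hasDerivAt_id s).const_mul 2).sub_const a).sub_const b).div_const (b - a))
    rw [hsq] at h
    refine h.congr_deriv ?_
    field_simp
  have hL : HasDerivAt (fun x => log (x - t)) (1 / (s - t)) s :=
    ((hasDerivAt_id s).sub_const t).log (sub_ne_zero.2 hst)
  have h := ((((((hX.const_mul √(b - t)).add (hY.const_mul √(t - a))).log hpos.ne').const_mul
    2).const_mul (√(b - t) * √(t - a))).sub (hY.mul hX)).add (hA.const_mul (t - (a + b) / 2)) |>.sub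
      (hL.const_mul (√(b - t) * √(t - a)))
  refine h.congr_deriv ?_
  rw [sqrt_mul hy.le]
  simp only [Pi.add_apply]
  have hts : t - s ≠ 0 := sub_ne_zero.2 hst.symm
  have hts' : s - t ≠ 0 := sub_ne_zero.2 hst
  have p2 := sq_sqrt hp.le
  have q2 := sq_sqrt hq.le
  have x2 := sq_sqrt hx.le
  have y2 := sq_sqrt hy.le
  have hp' := sqrt_pos.2 hp
  have hq' := sqrt_pos.2 hq
  have hx' := sqrt_pos.2 hx
  have hy' := sqrt_pos.2 hy
  generalize √(b - t) = p at *
  generalize √(t - a) = q at *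
  generalize √(s - a) = x at *
  generalize √(b - s) = y at *
  have hG : 2 * ((p * (1 / (2 * x)) + q * (-1 / (2 * y))) / (p * x + q * y)) - 1 / (s - t) =
      p * q / (x * y * (t - s)) := by
    have e : 1 / (s - t) = - (1 / (t - s)) := by rw [← neg_sub, one_div_neg_eq_neg_one_div]
    have key : (p * y - q * x) * (t - s) + x * y * (p * x + q * y) = p * q * (p * x + q * y) := by
      linear_combination q * x * (y2 - p2) - p * y * (q2 - x2)
    rw [e]
    field_simp
    linear_combination key
  have hR : p * q * (p * q / (x * y * (t - s))) -
      (-1 / (2 * y) * x + y * (1 / (2 * x))) + (t - (a + b) / 2) * (1 / (y * x)) =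
      y * x / (t - s) := by
    field_simp
    linear_combination 2 * q ^ 2 * p2 + 2 * (b - t) * q2 + (t - s) * (x2 - y2) -
      2 * y ^ 2 * x2 - 2 * (s - a) * y2
  linear_combination hR + p * q * hG

theorem integral_semicircle_div {a b t x y : ℝ} (ht : t ∈ Set.Ioo a b) (hax : a ≤ x)
    (hxy : x ≤ y) (hyb : y ≤ b) (hts : ∀ s ∈ Set.Icc x y, s ≠ t) :
    ∫ s in x..y, √((b - s) * (s - a)) / (t - s) =
      (semicirclePrimitive a b t y - √(b - t) * √(t - a) * log (y - t)) -
      (semicirclePrimitive a b t x - √(b - t) * √(t - a) * log (x - t)) := by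
  have hsub : Set.Icc x y ⊆ Set.Icc a b := Set.Icc_subset_Icc hax hyb
  refine intervalIntegral.integral_eq_sub_of_hasDerivAt_of_le hxy
    (f := fun s => semicirclePrimitive a b t s - √(b - t) * √(t - a) * log (s - t)) ?_ ?_ ?_
  · exact ((continuousOn_semicirclePrimitive ht).mono hsub).sub (continuousOn_const.mul
      (ContinuousOn.log (by fun_prop) fun s hs => sub_ne_zero.2 (hts s hs)))
  · intro s hs
    exact hasDerivAt_semicirclePrimitive ht ⟨hax.trans_lt hs.1, hs.2.trans_le hyb⟩
      (hts s ⟨hs.1.le, hs.2.le⟩)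
  · refine ContinuousOn.intervalIntegrable ?_
    rw [uIcc_of_le hxy]
    exact ContinuousOn.div (by fun_prop) (by fun_prop)
      fun s hs => sub_ne_zero.2 (hts s hs).symm

theorem semicirclePrimitive_endpoints {a b t : ℝ} (ht : t ∈ Set.Ioo a b) :
    (semicirclePrimitive a b t b - √(b - t) * √(t - a) * log (b - t)) -
      (semicirclePrimitive a b t a - √(b - t) * √(t - a) * log (a - t)) =
      π * (t - (a + b) / 2) := by
  have hp : 0 < b - t := sub_pos.2 ht.2
  have hq : 0 < t - a := sub_pos.2 ht.1
  have hr : 0 < b - a := by linarith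
  have e1 : (2 * b - a - b) / (b - a) = 1 := by rw [div_eq_iff hr.ne']; ring
  have e2 : (2 * a - a - b) / (b - a) = -1 := by rw [div_eq_iff hr.ne']; ring
  have e3 : log (a - t) = log (t - a) := by rw [← neg_sub, log_neg_eq_log]
  have hlog : ∀ u, 0 < u → 2 * log (√u * √(b - a)) = log u + log (b - a) := by
    intro u hu
    rw [log_mul (sqrt_pos.2 hu).ne' (sqrt_pos.2 hr).ne', log_sqrt hu.le, log_sqrt hr.le]
    ring
  simp only [semicirclePrimitive, e1, e2, e3, sub_self, sqrt_zero, mul_zero, zero_mul, add_zero,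
    zero_add, arcsin_one, arcsin_neg_one, hlog _ hp, hlog _ hq]
  ring

theorem hilbertAt_semicircle {a b t : ℝ} (ht : t ∈ Set.Ioo a b) :
    HilbertAt ((Set.Icc a b).indicator (fun s : ℝ => √((b - s) * (s - a)))) t
      (t - (a + b) / 2) := by
  rw [hilbertAt_indicator_iff ht (by fun_prop)]
  have hcont : ContinuousAt (semicirclePrimitive a b t) t :=
    (continuousOn_semicirclePrimitive ht).continuousAt (Icc_mem_nhds ht.1 ht.2)
  have hl : Tendsto (fun ε : ℝ => t - ε) (𝓝[>] 0) (𝓝 t) := by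
    have : Tendsto (fun ε : ℝ => t - ε) (𝓝 0) (𝓝 (t - 0)) := by
      exact (by fun_prop : Continuous fun ε : ℝ => t - ε).tendsto 0
    rw [sub_zero] at this
    exact this.mono_left nhdsWithin_le_nhds
  have hr : Tendsto (fun ε : ℝ => t + ε) (𝓝[>] 0) (𝓝 t) := by
    have : Tendsto (fun ε : ℝ => t + ε) (𝓝 0) (𝓝 (t + 0)) := by
      exact (by fun_prop : Continuous fun ε : ℝ => t + ε).tendsto 0
    rw [add_zero] at this
    exact this.mono_left nhdsWithin_le_nhds
  have hlim := (((hcont.tendsto.comp hl).sub (hcont.tendsto.comp hr)).add_const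
    (π * (t - (a + b) / 2))).const_mul (1 / π)
  rw [sub_self, zero_add, one_div_mul_eq_div, mul_div_cancel_left₀ _ pi_ne_zero] at hlim
  refine hlim.congr' ?_
  have h1 : ∀ᶠ ε in 𝓝[>] (0 : ℝ), ε < t - a :=
    nhdsWithin_le_nhds (eventually_lt_nhds (sub_pos.2 ht.1))
  have h2 : ∀ᶠ ε in 𝓝[>] (0 : ℝ), ε < b - t :=
    nhdsWithin_le_nhds (eventually_lt_nhds (sub_pos.2 ht.2))
  filter_upwards [self_mem_nhdsWithin, h1, h2] with ε hε h1 h2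
  have hε : 0 < ε := hε
  rw [integral_semicircle_div ht le_rfl (by linarith) (by linarith)
      fun s hs => (hs.2.trans_lt (by linarith)).ne,
    integral_semicircle_div ht (by linarith) (by linarith) le_rfl
      fun s hs => (lt_of_lt_of_le (by linarith) hs.1).ne',
    ← semicirclePrimitive_endpoints ht, sub_sub_cancel_left, add_sub_cancel_left, log_neg_eq_log]
  simp only [Function.comp_apply]
  ring

/-- The Hilbert transform of `χ_{[a,b]}(s) sᵏ √((b-s)(s-a))` is a polynomial of degree
`k + 1` on `(a,b)`. -/
theorem stmt10 (a b : ℝ) (hab : a < b) (k : ℕ) :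
    ∃ p : Polynomial ℝ, p.natDegree = k + 1 ∧
      ∀ t ∈ Set.Ioo a b,
        HilbertAt ((Set.Icc a b).indicator
          (fun s : ℝ => s ^ k * Real.sqrt ((b - s) * (s - a)))) t (p.eval t) := by
  induction k with
  | zero =>
    refine ⟨Polynomial.X - Polynomial.C ((a + b) / 2), by simp, fun t ht => ?_⟩
    simpa using hilbertAt_semicircle ht
  | succ k ih =>
    obtain ⟨p, hp, hH⟩ := ih
    have hp0 : p ≠ 0 := by
      rintro rfl
      simp at hp
    refine ⟨Polynomial.X * p -
      Polynomial.C ((1 / π) * ∫ s in a..b, s ^ k * √((b - s) * (s - a))), ?_, fun t ht => ?_⟩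
    · rw [Polynomial.natDegree_sub_C, Polynomial.natDegree_X_mul hp0, hp]
    · have h := (hH t ht).indicator_id_mul ht (by fun_prop)
      simpa only [Polynomial.eval_sub, Polynomial.eval_mul, Polynomial.eval_X, Polynomial.eval_C,
        pow_succ', mul_assoc] using h

end
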